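/- π/4 = 83·arctan(1/107) + 17·arctan(1/1710) − 22·arctan(1/103697) − 12·arctan(1/1256744) − 22·arctan(1/9140003941) + 12·arctan(1/3158812219818) + 22·arctan(1/167079344092131066905). -/

import Mathlib

open Real

theorem Complex.arg_eq_arctan_of_re_pos {z : ℂ} (hz : 0 < z.re) :
    z.arg = Real.arctan (z.im / z.re) := by
  have h := abs_lt.1 (Complex.abs_arg_lt_pi_div_two_iff.2 (Or.inl hz))
  rw [← Complex.tan_arg, Real.arctan_tan h.1 h.2]

theorem GaussianInt.arg_toComplex_eq_arctan {z : GaussianInt} (hz : 0 < z.re) :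
    (GaussianInt.toComplex z).arg = Real.arctan (z.im / z.re) := by
  rw [Complex.arg_eq_arctan_of_re_pos] <;> simp only [← GaussianInt.intCast_re,
    ← GaussianInt.intCast_im]
  exact_mod_cast hz

theorem GaussianInt.coe_arg_toComplex_mul {z w : GaussianInt} (hz : z ≠ 0) (hw : w ≠ 0) :
    ((GaussianInt.toComplex (z * w)).arg : Real.Angle) =
      (GaussianInt.toComplex z).arg + (GaussianInt.toComplex w).arg := by
  rw [map_mul, Complex.arg_mul_coe_angle] <;> simpa using by assumption

theorem GaussianInt.coe_arg_toComplex_pow (z : GaussianInt) (n : ℕ) :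
    ((GaussianInt.toComplex (z ^ n)).arg : Real.Angle) =
      n • ((GaussianInt.toComplex z).arg : Real.Angle) := by
  rw [map_pow, Complex.arg_pow_coe_angle]

theorem Real.arctan_lt_self {x : ℝ} (hx : 0 < x) : Real.arctan x < x := by
  simpa using Real.lt_tan (Real.arctan_pos.2 hx) (Real.arctan_lt_pi_div_two x)

theorem Zsqrtd.mk_mul_mk {d : ℤ} (a b c e : ℤ) :
    (⟨a, b⟩ * ⟨c, e⟩ : ℤ√d) = ⟨a * c + d * b * e, a * e + b * c⟩ := rfl

theorem GaussianInt.machin_product_re_eq_im :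
    let z : GaussianInt := ⟨107, 1⟩ ^ 83 * ⟨1710, 1⟩ ^ 17 * ⟨103697, -1⟩ ^ 22 *
      ⟨1256744, -1⟩ ^ 12 * ⟨9140003941, -1⟩ ^ 22 * ⟨3158812219818, 1⟩ ^ 12 *
      ⟨167079344092131066905, 1⟩ ^ 22
    z.re = z.im ∧ 0 < z.re := by
  norm_num [pow_succ, Zsqrtd.mk_mul_mk]

theorem machin_like_seven_term_from_wetherfield :
    π / 4 =
      83 * Real.arctan (1 / 107) + 17 * Real.arctan (1 / 1710)
        - 22 * Real.arctan (1 / 103697)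
        - 12 * Real.arctan (1 / 1256744)
        - 22 * Real.arctan (1 / 9140003941)
        + 12 * Real.arctan (1 / 3158812219818)
        + 22 * Real.arctan (1 / 167079344092131066905) := by
  have key : ((π / 4 : ℝ) : Real.Angle) =
      ((83 * Real.arctan (1 / 107) + 17 * Real.arctan (1 / 1710)
        - 22 * Real.arctan (1 / 103697)
        - 12 * Real.arctan (1 / 1256744)
        - 22 * Real.arctan (1 / 9140003941)
        + 12 * Real.arctan (1 / 3158812219818)
        + 22 * Real.arctan (1 / 167079344092131066905) : ℝ) : Real.Angle) := by
    obtain ⟨hre, hpos⟩ := GaussianInt.machin_product_re_eq_im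
    have harg := GaussianInt.arg_toComplex_eq_arctan hpos
    rw [← hre, div_self (by exact_mod_cast hpos.ne'), Real.arctan_one] at harg
    have hne (a b : ℤ) (ha : a ≠ 0) : (⟨a, b⟩ : GaussianInt) ≠ 0 := fun h =>
      ha (congrArg Zsqrtd.re h)
    rw [← harg]
    repeat rw [GaussianInt.coe_arg_toComplex_mul
      (by simp only [ne_eq, mul_eq_zero, pow_eq_zero_iff, OfNat.ofNat_ne_zero, not_false_eq_true,
            hne, or_self])
      (pow_ne_zero _ (hne _ _ (by norm_num)))]
    simp only [GaussianInt.coe_arg_toComplex_pow]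
    repeat rw [GaussianInt.arg_toComplex_eq_arctan (by norm_num)]
    simp only [← Real.Angle.coe_nsmul, ← Real.Angle.coe_add, nsmul_eq_mul]
    refine congrArg Real.Angle.coe ?_
    push_cast
    simp only [neg_div, Real.arctan_neg]
    ring
  have bounds (n : ℝ) (hn : 0 < n) : 0 < Real.arctan (1 / n) ∧ Real.arctan (1 / n) < 1 / n :=
    ⟨Real.arctan_pos.2 (by positivity), Real.arctan_lt_self (by positivity)⟩
  have h₁ := bounds 107 (by norm_num)
  have h₂ := bounds 1710 (by norm_num)
  have h₃ := bounds 103697 (by norm_num)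
  have h₄ := bounds 1256744 (by norm_num)
  have h₅ := bounds 9140003941 (by norm_num)
  have h₆ := bounds 3158812219818 (by norm_num)
  have h₇ := bounds 167079344092131066905 (by norm_num)
  have hpi := Real.pi_gt_three
  rw [← Real.Angle.toReal_coe_eq_self_iff.2 (⟨by linarith, by linarith⟩ : -π < π / 4 ∧ π / 4 ≤ π),
    key, Real.Angle.toReal_coe_eq_self_iff]
  constructor <;> linarith
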